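/- The q-analog F_{M,m}(q) = q^{Σ_{a=1}^{k-1} μ_{a+1}(λ_a − μ_a)} ∏_{a=1}^{k} [λ_a − μ_{a+1} choose μ_a − μ_{a+1}]_q specializes at q = 1 to the coefficient of x_1^{m_1}···x_k^{m_k} in (1+x_1)^{M_1}(1+x_1+x_2)^{M_2}···(1+x_1+···+x_k)^{M_k}, where [· choose ·]_q is the Gaussian (q-)binomial coefficient, λ_a = Σ_{i=a}^k M_i and μ_a = Σ_{i=a}^k m_i. -/

import Mathlib

/-- The Gaussian (q-)binomial coefficient as a polynomial in q, defined by the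
q-Pascal recursion; it is 0 when the bottom exceeds the top. -/
noncomputable def gaussBinom : ℕ → ℕ → Polynomial ℤ
  | _, 0 => 1
  | 0, _ + 1 => 0
  | m + 1, n + 1 => gaussBinom m n + Polynomial.X ^ (n + 1) * gaussBinom m (n + 1)

/-- The q-supernomial coefficient F_{M,m}(q)
  = q^{Σ_{a=1}^{k-1} μ_{a+1}(λ_a−μ_a)} ∏_{a=1}^k [λ_a−μ_{a+1} choose μ_a−μ_{a+1}]_q,
where λ_a = Σ_{i=a}^k M_i and μ_a = Σ_{i=a}^k m_i. -/
noncomputable def Fqs (k : ℕ) (M m : ℕ → ℕ) : Polynomial ℤ :=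
  Polynomial.X ^
      (∑ a ∈ Finset.Icc 1 (k - 1),
        (∑ i ∈ Finset.Icc (a + 1) k, m i) *
          ((∑ i ∈ Finset.Icc a k, M i) - (∑ i ∈ Finset.Icc a k, m i))) *
    ∏ a ∈ Finset.Icc 1 k,
      gaussBinom ((∑ i ∈ Finset.Icc a k, M i) - (∑ i ∈ Finset.Icc (a + 1) k, m i))
        ((∑ i ∈ Finset.Icc a k, m i) - (∑ i ∈ Finset.Icc (a + 1) k, m i))

open Finset MvPolynomial in
/-- If `p` does not involve the variable `i`, then `X i ^ j * p` contributes to the coefficient of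
`x ^ m` only when `j = m i`. -/
theorem MvPolynomial.coeff_X_pow_mul_of_notMem_vars {σ R : Type*} [DecidableEq σ] [CommSemiring R]
    {p : MvPolynomial σ R} {i : σ} (hp : i ∉ p.vars) (j : ℕ) (m : σ →₀ ℕ) :
    coeff m (X i ^ j * p) = if j = m i then coeff (m.erase i) p else 0 := by
  rw [X_pow_eq_monomial, coeff_monomial_mul', one_mul]
  split_ifs with h1 h2 h2
  · congr 1
    ext x
    by_cases hx : x = i
    · subst hx; simp [h2]
    · simp [hx]
  · by_contra hne
    have h0 := mem_support_notMem_vars_zero (MvPolynomial.mem_support_iff.mpr hne) hp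
    have hj : j ≤ m i := by simpa using h1 i
    simp only [Finsupp.coe_tsub, Pi.sub_apply, Finsupp.single_eq_same] at h0
    omega
  · exact absurd (Finsupp.single_le_iff.mpr h2.le) h1
  · rfl

theorem gaussBinom_eval_one (m n : ℕ) :
    Polynomial.eval 1 (gaussBinom m n) = (m.choose n : ℤ) := by
  induction m generalizing n with
  | zero => cases n <;> simp [gaussBinom]
  | succ m ih =>
    cases n with
    | zero => simp [gaussBinom]
    | succ n => simp [gaussBinom, ih, Nat.choose_succ_succ]

open Finset MvPolynomial in
/-- The coefficients of `(1 + x₁)^{M₁} ⋯ (1 + x₁ + ⋯ + xₖ)^{Mₖ} (1 + x₁ + ⋯ + xₖ)^N`. -/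
theorem coeff_prod_one_add_sum_X_pow (k : ℕ) (M : ℕ → ℕ) (N : ℕ) (m : ℕ →₀ ℕ)
    (hm : (m.support : Set ℕ) ⊆ Set.Icc 1 k) :
    coeff m ((∏ a ∈ Icc 1 k, (1 + ∑ i ∈ Icc 1 a, (X i : MvPolynomial ℕ ℤ)) ^ M a) *
        (1 + ∑ i ∈ Icc 1 k, (X i : MvPolynomial ℕ ℤ)) ^ N) =
      ∏ a ∈ Icc 1 k,
        (((N + ∑ i ∈ Icc a k, M i) - ∑ i ∈ Icc (a + 1) k, m i).choose (m a) : ℤ) := by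
  induction k generalizing N m with
  | zero =>
    have h0 : m = 0 := by
      rw [← Finsupp.support_eq_empty, ← Finset.coe_eq_empty]
      exact Set.subset_empty_iff.mp (by simpa using hm)
    simp [h0]
  | succ k ih =>
    set S : MvPolynomial ℕ ℤ := 1 + ∑ i ∈ Icc 1 k, X i with hS
    set P : MvPolynomial ℕ ℤ := ∏ a ∈ Icc 1 k, (1 + ∑ i ∈ Icc 1 a, X i) ^ M a with hP
    set n := N + M (k + 1) with hn
    have hsum : ∀ b, b ≤ k → (1 + ∑ i ∈ Icc 1 b, X i : MvPolynomial ℕ ℤ) ∈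
        supported ℤ (Set.Iic k) := fun b hb =>
      add_mem (one_mem _) (sum_mem fun i hi =>
        X_mem_supported.mpr (le_trans (Finset.mem_Icc.mp hi).2 hb))
    have hvars : ∀ r, k + 1 ∉ (P * S ^ r).vars := fun r hr => by
      have hmem : P * S ^ r ∈ supported ℤ (Set.Iic k) :=
        mul_mem (prod_mem fun a ha => pow_mem (hsum a (Finset.mem_Icc.mp ha).2) _)
          (pow_mem (hsum k le_rfl) _)
      have := mem_supported.mp hmem hr
      simp at this
    have hexp : (∏ a ∈ Icc 1 (k + 1), (1 + ∑ i ∈ Icc 1 a, (X i : MvPolynomial ℕ ℤ)) ^ M a) *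
        (1 + ∑ i ∈ Icc 1 (k + 1), (X i : MvPolynomial ℕ ℤ)) ^ N =
        ∑ j ∈ range (n + 1), (n.choose j) • (X (k + 1) ^ j * (P * S ^ (n - j))) := by
      rw [prod_Icc_succ_top (by omega), sum_Icc_succ_top (by omega), ← add_assoc, ← hS, ← hP,
        mul_assoc, ← pow_add, add_comm (M (k + 1)) N, ← hn, add_comm S, add_pow, mul_sum]
      refine sum_congr rfl fun j _ => ?_
      rw [nsmul_eq_mul]
      ring
    have herase : ((m.erase (k + 1)).support : Set ℕ) ⊆ Set.Icc 1 k := fun i hi => by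
      simp only [Finsupp.support_erase, coe_erase, Set.mem_sdiff, Set.mem_singleton_iff] at hi
      have := hm hi.1
      simp only [Set.mem_Icc] at this ⊢
      omega
    have hcoeff : coeff m (∑ j ∈ range (n + 1), (n.choose j) • (X (k + 1) ^ j *
        (P * S ^ (n - j)))) = (n.choose (m (k + 1)) : ℤ) *
          coeff (m.erase (k + 1)) (P * S ^ (n - m (k + 1))) := by
      simp only [coeff_sum, coeff_smul, coeff_X_pow_mul_of_notMem_vars (hvars _), smul_ite,
        smul_zero, sum_ite_eq', mem_range]
      split_ifs with h
      · rw [nsmul_eq_mul]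
      · rw [Nat.choose_eq_zero_of_lt (by omega)]
        simp
    rw [hexp, hcoeff, ih _ _ herase, prod_Icc_succ_top (by omega), mul_comm]
    rcases lt_or_ge n (m (k + 1)) with hlt | hle
    · simp [← hn, Nat.choose_eq_zero_of_lt hlt]
    · congr 1
      · refine prod_congr rfl fun a ha => ?_
        have ha' := Finset.mem_Icc.mp ha
        rw [sum_Icc_succ_top (by omega), sum_Icc_succ_top (by omega),
          Finsupp.erase_ne (by omega : a ≠ k + 1),
          sum_congr rfl fun i hi => Finsupp.erase_ne (f := m)
            (by have := Finset.mem_Icc.mp hi; omega : i ≠ k + 1)]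
        congr 2
        omega
      · simp [← hn]

/-- F_{M,m}(q) specializes at q = 1 to the coefficient of
x_1^{m_1}⋯x_k^{m_k} in (1+x_1)^{M_1}⋯(1+x_1+⋯+x_k)^{M_k}. -/
theorem Fqs_eval_one (k : ℕ) (M : ℕ → ℕ) (m : ℕ →₀ ℕ)
    (hm : (m.support : Set ℕ) ⊆ Set.Icc 1 k) :
    Polynomial.eval 1 (Fqs k M m) =
      MvPolynomial.coeff m
        (∏ a ∈ Finset.Icc 1 k,
          (1 + ∑ i ∈ Finset.Icc 1 a, (MvPolynomial.X i : MvPolynomial ℕ ℤ)) ^ M a) := by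
  have h := coeff_prod_one_add_sum_X_pow k M 0 m hm
  rw [pow_zero, mul_one] at h
  rw [h, Fqs, Polynomial.eval_mul, Polynomial.eval_pow, Polynomial.eval_X, one_pow, one_mul,
    Polynomial.eval_prod]
  refine Finset.prod_congr rfl fun a ha => ?_
  rw [gaussBinom_eval_one, zero_add, ← Finset.add_sum_Ioc_eq_sum_Icc (f := m)
    (Finset.mem_Icc.mp ha).2, ← Finset.Icc_succ_left_eq_Ioc, Order.succ_eq_add_one,
    Nat.add_sub_cancel]
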